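/- arXiv:0911.3433 — 9 statements merged into one kernel-verified Lean document; each statement's English description precedes it below -/
import Mathlib

section
/- Let n, e₁, e₂, e₃ ∈ ℝ⁴ satisfy η(n,n) = −1 and η(n,e_a) = 0 for a = 1,2,3, where η is the Minkowski bilinear form. Let q be the 3×3 Gram matrix q_{ab} = η(e_a,e_b); assume det q > 0 and that the 4×4 matrix with columns n, e₁, e₂, e₃ has determinant √(det q). Let N, N¹, N², N³ ∈ ℝ and set e_t := N·n + Σ_a N^a e_a. Define X_{μν}^{IJ} := Σ_{M,N,K,L} η^{IM} η^{JN} ε_{MNKL} e_μ^K e_ν^L for μ,ν ∈ {t,1,2,3}, and π^{aIJ} := (1/2) Σ_{b,c∈{1,2,3}} ε_{abc} X_{bc}^{IJ}. Then for all a ∈ {1,2,3} and all I,J ∈ {0,1,2,3}: X_{ta}^{IJ} = Σ_{b,c} ε_{abc} N^c π^{bIJ} + (N/√(det q)) Σ_{b,c,K,L} ε_{abc} π^{bIK} η_{KL} π^{cLJ}. -/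
open scoped BigOperators

/-- Levi-Civita symbol on indices `{1,2,3}` (here `Fin 3`), with `ε_{123} = 1`. -/
noncomputable def eps3 (a b c : Fin 3) : ℝ :=
  Matrix.det (Matrix.of fun i j => if (![a, b, c]) i = j then (1 : ℝ) else 0)

/-- Levi-Civita symbol on indices `{0,1,2,3}` (here `Fin 4`), with `ε_{0123} = 1`. -/
noncomputable def eps4 (a b c d : Fin 4) : ℝ :=
  Matrix.det (Matrix.of fun i j => if (![a, b, c, d]) i = j then (1 : ℝ) else 0)

/-- The Minkowski metric matrix `η = diag(-1,1,1,1)`. -/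
noncomputable def eta (I J : Fin 4) : ℝ :=
  if I = J then (if I = 0 then -1 else 1) else 0

/-- The Minkowski bilinear form `η(x,y) = -x₀y₀ + x₁y₁ + x₂y₂ + x₃y₃` on `ℝ⁴`. -/
noncomputable def mink (x y : Fin 4 → ℝ) : ℝ := ∑ I, ∑ J, eta I J * x I * y J

namespace HolstX

open Matrix

/-- The integer Levi-Civita symbol on three indices. -/
def lc3 (a b c : Fin 3) : ℤ :=
  ((b : ℤ) - a) * ((c : ℤ) - a) * ((c : ℤ) - b) / 2

/-- The integer Levi-Civita symbol on four indices. -/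
def lc4 (a b c d : Fin 4) : ℤ :=
  ((b : ℤ) - a) * ((c : ℤ) - a) * ((d : ℤ) - a) * ((c : ℤ) - b) * ((d : ℤ) - b) *
    ((d : ℤ) - c) / 12

/-- The elementary bivector pairing the time index with the spatial index `b`. -/
def boost (b : Fin 3) (α β : Fin 4) : ℤ :=
  if α = 0 ∧ β = b.succ then 1 else if α = b.succ ∧ β = 0 then -1 else 0

lemma det_fin_four {R : Type*} [CommRing R] (A : Matrix (Fin 4) (Fin 4) R) :
    A.det =
      A 0 0 * (A 1 1 * (A 2 2 * A 3 3 - A 2 3 * A 3 2) - A 1 2 * (A 2 1 * A 3 3 - A 2 3 * A 3 1)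
        + A 1 3 * (A 2 1 * A 3 2 - A 2 2 * A 3 1))
      - A 0 1 * (A 1 0 * (A 2 2 * A 3 3 - A 2 3 * A 3 2) - A 1 2 * (A 2 0 * A 3 3 - A 2 3 * A 3 0)
        + A 1 3 * (A 2 0 * A 3 2 - A 2 2 * A 3 0))
      + A 0 2 * (A 1 0 * (A 2 1 * A 3 3 - A 2 3 * A 3 1) - A 1 1 * (A 2 0 * A 3 3 - A 2 3 * A 3 0)
        + A 1 3 * (A 2 0 * A 3 1 - A 2 1 * A 3 0))
      - A 0 3 * (A 1 0 * (A 2 1 * A 3 2 - A 2 2 * A 3 1) - A 1 1 * (A 2 0 * A 3 2 - A 2 2 * A 3 0)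
        + A 1 2 * (A 2 0 * A 3 1 - A 2 1 * A 3 0)) := by
  simp [det_succ_row_zero, Fin.sum_univ_succ, Fin.succAbove]
  ring

lemma eps3_eq (a b c : Fin 3) : eps3 a b c = lc3 a b c := by
  have h : ∀ a b c : Fin 3,
      (Matrix.of fun i j => if (![a, b, c]) i = j then (1 : ℤ) else 0).det = lc3 a b c := by
    simp only [det_fin_three, of_apply]
    decide +kernel
  rw [← h, Int.cast_det, eps3]
  congr 1
  ext i j
  simp

lemma eps4_eq (a b c d : Fin 4) : eps4 a b c d = lc4 a b c d := by
  have h : ∀ a b c d : Fin 4,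
      (Matrix.of fun i j => if (![a, b, c, d]) i = j then (1 : ℤ) else 0).det = lc4 a b c d := by
    simp only [det_fin_four, of_apply]
    decide +kernel
  rw [← h, Int.cast_det, eps4]
  congr 1
  ext i j
  simp

lemma sum_lc3_mul_lc4 (b : Fin 3) (α β : Fin 4) :
    ∑ c, ∑ d, lc3 b c d * lc4 α β c.succ d.succ = 2 * boost b α β := by
  revert b α β
  decide +kernel

lemma lc4_succ_succ (a c : Fin 3) (α β : Fin 4) :
    lc4 α β c.succ a.succ = ∑ b, lc3 a b c * boost b α β := by
  revert a c α β
  decide +kernel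

lemma det_rows_eq_sum (a b c d : Fin 4 → ℝ) :
    ∑ M, ∑ N, ∑ K, ∑ L, eps4 M N K L * a M * b N * c K * d L = (Matrix.of ![a, b, c, d]).det := by
  simp only [eps4_eq, det_fin_four, Fin.sum_univ_four]
  simp [lc4]
  ring

lemma det_rows_eq_det_mul_eps4 (F : Matrix (Fin 4) (Fin 4) ℝ) (α β γ δ : Fin 4) :
    (Matrix.of ![F α, F β, F γ, F δ]).det = F.det * eps4 α β γ δ := by
  rw [eps4, mul_comm, ← det_mul]
  congr 1
  ext i j
  have h (x : Fin 4) : F x j = ∑ k, (if x = k then (1 : ℝ) else 0) * F k j := by simp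
  rw [mul_apply]
  fin_cases i
  exacts [h α, h β, h γ, h δ]

/-- The Minkowski metric as a matrix. -/
noncomputable def etaM : Matrix (Fin 4) (Fin 4) ℝ := Matrix.of eta

lemma etaM_eq : etaM = diagonal fun I => if I = 0 then -1 else 1 := by
  ext I J
  simp [etaM, eta, diagonal_apply]

lemma etaM_mul_self : etaM * etaM = 1 := by
  rw [etaM_eq, diagonal_mul_diagonal, ← diagonal_one]
  congr 1
  ext I
  split_ifs <;> simp

lemma etaM_transpose : etaMᵀ = etaM := by
  rw [etaM_eq, diagonal_transpose]

/-- The matrix of `ε_{MNKL} x^K y^L`. -/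
noncomputable def dual (x y : Fin 4 → ℝ) : Matrix (Fin 4) (Fin 4) ℝ :=
  Matrix.of fun M N => ∑ K, ∑ L, eps4 M N K L * x K * y L

/-- The Hodge dual of `x ∧ y` with raised indices. -/
noncomputable def hodge (x y : Fin 4 → ℝ) : Matrix (Fin 4) (Fin 4) ℝ := etaM * dual x y * etaM

lemma hodge_apply (x y : Fin 4 → ℝ) (I J : Fin 4) :
    hodge x y I J =
      ∑ M, ∑ N, ∑ K, ∑ L, eta I M * eta J N * eps4 M N K L * x K * y L := by
  have h (M N : Fin 4) : ∑ K, ∑ L, eta I M * eta J N * eps4 M N K L * x K * y L =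
      eta I M * eta J N * dual x y M N := by
    simp only [dual, of_apply, Finset.mul_sum, mul_assoc]
  simp only [h, hodge, etaM_eq, mul_diagonal, diagonal_mul]
  simp [eta]

lemma dual_congr (F : Matrix (Fin 4) (Fin 4) ℝ) (γ δ α β : Fin 4) :
    (F * dual (F γ) (F δ) * Fᵀ) α β = F.det * eps4 α β γ δ := by
  rw [← det_rows_eq_det_mul_eps4, ← det_rows_eq_sum]
  simp only [mul_apply, dual, of_apply, transpose_apply, Finset.mul_sum, Finset.sum_mul]
  rw [Finset.sum_comm]
  refine Finset.sum_congr rfl fun M _ => Finset.sum_congr rfl fun N _ =>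
    Finset.sum_congr rfl fun K _ => Finset.sum_congr rfl fun L _ => ?_
  ring

/-- Components of a bivector in the frame given by the rows of `F`, with lowered indices. -/
noncomputable def frame (F T : Matrix (Fin 4) (Fin 4) ℝ) : Matrix (Fin 4) (Fin 4) ℝ :=
  F * etaM * T * etaM * Fᵀ

lemma frame_hodge (F : Matrix (Fin 4) (Fin 4) ℝ) (γ δ α β : Fin 4) :
    frame F (hodge (F γ) (F δ)) α β = F.det * lc4 α β γ δ := by
  rw [← eps4_eq, ← dual_congr]
  suffices F * etaM * hodge (F γ) (F δ) * etaM = F * dual (F γ) (F δ) by rw [frame, this]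
  calc F * etaM * (etaM * dual (F γ) (F δ) * etaM) * etaM
      = F * (etaM * etaM) * dual (F γ) (F δ) * (etaM * etaM) := by simp only [Matrix.mul_assoc]
    _ = F * dual (F γ) (F δ) := by rw [etaM_mul_self, Matrix.mul_one, Matrix.mul_one]

lemma isUnit_etaM : IsUnit etaM := IsUnit.of_mul_eq_one _ etaM_mul_self

lemma frame_injective {F : Matrix (Fin 4) (Fin 4) ℝ} (hF : IsUnit F) :
    Function.Injective (frame F) := by
  intro S T h
  have hFt : IsUnit Fᵀ := by rwa [isUnit_transpose]
  exact (hF.mul isUnit_etaM).mul_right_injective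
    (isUnit_etaM.mul_left_injective (hFt.mul_left_injective h))

lemma frame_smul (F T : Matrix (Fin 4) (Fin 4) ℝ) (c : ℝ) : frame F (c • T) = c • frame F T := by
  simp [frame]

lemma frame_sum {ι : Type*} (s : Finset ι) (F : Matrix (Fin 4) (Fin 4) ℝ)
    (T : ι → Matrix (Fin 4) (Fin 4) ℝ) : frame F (∑ i ∈ s, T i) = ∑ i ∈ s, frame F (T i) := by
  simp [frame, Matrix.mul_sum, Matrix.sum_mul]

lemma frame_mul {F : Matrix (Fin 4) (Fin 4) ℝ} (hF : IsUnit F) (S T : Matrix (Fin 4) (Fin 4) ℝ) :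
    frame F (S * etaM * T) = frame F S * (F * etaM * Fᵀ)⁻¹ * frame F T := by
  have hdet : IsUnit F.det := (isUnit_iff_isUnit_det F).1 hF
  have hdett : IsUnit Fᵀ.det := by rwa [det_transpose]
  have hinv : (F * etaM * Fᵀ)⁻¹ = Fᵀ⁻¹ * etaM * F⁻¹ := by
    rw [Matrix.mul_inv_rev, Matrix.mul_inv_rev, inv_eq_left_inv etaM_mul_self, Matrix.mul_assoc]
  rw [hinv]
  calc frame F (S * etaM * T)
      = F * etaM * S * etaM * T * etaM * Fᵀ := by simp only [frame, Matrix.mul_assoc]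
    _ = F * etaM * S * etaM * (Fᵀ * Fᵀ⁻¹) * etaM * (F⁻¹ * F) * etaM * T * etaM * Fᵀ := by
      rw [mul_nonsing_inv _ hdett, nonsing_inv_mul _ hdet, Matrix.mul_one, Matrix.mul_one,
        Matrix.mul_assoc (F * etaM * S * etaM) etaM etaM, etaM_mul_self, Matrix.mul_one]
    _ = _ := by simp only [frame, Matrix.mul_assoc]

lemma boost_mul_mul_boost {H : Matrix (Fin 4) (Fin 4) ℝ} (hsymm : Hᵀ = H)
    (h00 : H 0 0 = -1) (h0 : ∀ a : Fin 3, H 0 a.succ = 0) (b c : Fin 3) (α β : Fin 4) :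
    ((Matrix.of fun α β => (boost b α β : ℝ)) * H *
      Matrix.of fun α β => (boost c α β : ℝ)) α β =
        if α = b.succ ∧ β = c.succ then 1
        else if α = 0 ∧ β = 0 then -H b.succ c.succ else 0 := by
  have h0' (a : Fin 3) : H a.succ 0 = 0 := (congrFun₂ hsymm a.succ 0).symm.trans (h0 a)
  simp only [mul_apply, of_apply]
  cases α using Fin.cases <;> cases β using Fin.cases <;>
    simp [Fin.sum_univ_succ (n := 3), boost, h00, h0, h0', Fin.succ_ne_zero,
      (Fin.succ_ne_zero _).symm, ← ite_and, and_comm]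

lemma sum_boost_mul_mul_boost {H : Matrix (Fin 4) (Fin 4) ℝ} (hsymm : Hᵀ = H)
    (h00 : H 0 0 = -1) (h0 : ∀ a : Fin 3, H 0 a.succ = 0) (a : Fin 3) :
    ∑ b, ∑ c, (lc3 a b c : ℝ) • ((Matrix.of fun α β => (boost b α β : ℝ)) * H *
      Matrix.of fun α β => (boost c α β : ℝ)) =
        Matrix.of fun α β => (lc4 α β 0 a.succ : ℝ) := by
  have hs (i j : Fin 4) : H i j = H j i := congrFun₂ hsymm j i
  ext α β
  simp only [Matrix.sum_apply, Matrix.smul_apply, boost_mul_mul_boost hsymm h00 h0, of_apply,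
    smul_eq_mul]
  by_cases h : α = 0 ∧ β = 0
  · obtain ⟨rfl, rfl⟩ := h
    fin_cases a <;>
      simp [Fin.sum_univ_three, (Fin.succ_ne_zero _).symm, lc3, lc4, hs 2 1, hs 3 1, hs 3 2]
  · have key : ∀ (a : Fin 3) (α β : Fin 4), ¬(α = 0 ∧ β = 0) →
        ∑ b, ∑ c, lc3 a b c * (if α = b.succ ∧ β = c.succ then 1 else 0) =
          lc4 α β 0 a.succ := by
      decide +kernel
    simp only [if_neg h]
    exact_mod_cast key a α β h

/-- The bivectors `π^b` of the spatial triad formed by the last three rows of `F`. -/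
noncomputable def triadPi (F : Matrix (Fin 4) (Fin 4) ℝ) (b : Fin 3) :
    Matrix (Fin 4) (Fin 4) ℝ :=
  (1 / 2 : ℝ) • ∑ c : Fin 3, ∑ d : Fin 3, (lc3 b c d : ℝ) • hodge (F c.succ) (F d.succ)

lemma frame_triadPi (F : Matrix (Fin 4) (Fin 4) ℝ) (b : Fin 3) :
    frame F (triadPi F b) = F.det • Matrix.of fun α β => (boost b α β : ℝ) := by
  ext α β
  have hb : ∑ c : Fin 3, ∑ d : Fin 3, (lc3 b c d : ℝ) * lc4 α β c.succ d.succ =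
      2 * boost b α β := by
    exact_mod_cast sum_lc3_mul_lc4 b α β
  simp only [triadPi, frame_smul, frame_sum, Matrix.smul_apply, Matrix.sum_apply, smul_eq_mul,
    of_apply, frame_hodge, mul_left_comm _ F.det, ← Finset.mul_sum, hb]
  ring

lemma hodge_triad {F : Matrix (Fin 4) (Fin 4) ℝ} (hF : IsUnit F) (c a : Fin 3) :
    hodge (F c.succ) (F a.succ) = ∑ b, (lc3 a b c : ℝ) • triadPi F b := by
  apply frame_injective hF
  ext α β
  simp only [frame_hodge, lc4_succ_succ, frame_sum, frame_smul, frame_triadPi, Matrix.sum_apply,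
    Matrix.smul_apply, of_apply, smul_eq_mul]
  push_cast
  rw [Finset.mul_sum]
  exact Finset.sum_congr rfl fun b _ => by ring

lemma gram_apply (F : Matrix (Fin 4) (Fin 4) ℝ) (α β : Fin 4) :
    (F * etaM * Fᵀ) α β = mink (F α) (F β) := by
  rw [etaM_eq]
  simp [mul_apply, mink, eta, Fin.sum_univ_four, diagonal_apply]

lemma hodge_normal {F : Matrix (Fin 4) (Fin 4) ℝ} (hF : IsUnit F)
    (hn : mink (F 0) (F 0) = -1) (hne : ∀ a : Fin 3, mink (F 0) (F a.succ) = 0) (a : Fin 3) :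
    F.det • hodge (F 0) (F a.succ) =
      ∑ b, ∑ c, (lc3 a b c : ℝ) • (triadPi F b * etaM * triadPi F c) := by
  set G := F * etaM * Fᵀ with hG
  have hGu : IsUnit G.det := by
    rw [← isUnit_iff_isUnit_det]
    exact (hF.mul isUnit_etaM).mul (by rwa [isUnit_transpose])
  have hGs : Gᵀ = G := by
    simp only [hG, transpose_mul, transpose_transpose, etaM_transpose, Matrix.mul_assoc]
  have hG00 : G 0 0 = -1 := by rw [hG, gram_apply, hn]
  have hG0 (b : Fin 3) : G 0 b.succ = 0 := by rw [hG, gram_apply, hne]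
  have hrow (β : Fin 4) : -G⁻¹ 0 β = (1 : Matrix (Fin 4) (Fin 4) ℝ) 0 β := by
    rw [← mul_nonsing_inv G hGu, mul_apply, Fin.sum_univ_succ]
    simp [hG00, hG0]
  have key := sum_boost_mul_mul_boost (H := G⁻¹) (by rw [transpose_nonsing_inv, hGs])
    (by rw [← neg_eq_iff_eq_neg, hrow, one_apply_eq])
    (fun b => by rw [← neg_eq_zero, hrow, one_apply_ne (Fin.succ_ne_zero b).symm]) a
  apply frame_injective hF
  have h : frame F (hodge (F 0) (F a.succ)) =
      F.det • Matrix.of fun α β => (lc4 α β 0 a.succ : ℝ) := by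
    ext α β
    exact frame_hodge F 0 a.succ α β
  simp only [frame_smul, frame_sum, frame_mul hF, h, ← key, frame_triadPi, ← hG, Finset.smul_sum,
    Matrix.smul_mul, Matrix.mul_smul]
  refine Finset.sum_congr rfl fun b _ => Finset.sum_congr rfl fun c _ => ?_
  simp only [smul_smul]
  congr 1
  ring

lemma hodge_lapse_shift (n y : Fin 4 → ℝ) (e : Fin 3 → Fin 4 → ℝ) (N : ℝ) (v : Fin 3 → ℝ) :
    hodge (fun I => N * n I + ∑ a, v a * e a I) y = N • hodge n y + ∑ c, v c • hodge (e c) y := by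
  have h : dual (fun I => N * n I + ∑ a, v a * e a I) y =
      N • dual n y + ∑ c, v c • dual (e c) y := by
    ext M K
    simp only [dual, of_apply, Matrix.add_apply, Matrix.smul_apply, smul_eq_mul,
      Fin.sum_univ_three, Finset.mul_sum, ← Finset.sum_add_distrib]
    refine Finset.sum_congr rfl fun _ _ => Finset.sum_congr rfl fun _ _ => ?_
    ring
  simp [hodge, h, Matrix.mul_add, Matrix.add_mul, Matrix.mul_sum, Matrix.sum_mul]

end HolstX


/-- For a tetrad built from a unit timelike normal `n`, spatial co-triad
`e₁,e₂,e₃` orthogonal to `n` (with `det q > 0` and positively oriented), lapse `N` and shift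
`Nᵃ`, the time–space components of `X^{IJ}_{μν} = η^{IM}η^{JN}ε_{MNKL}e_μ^K e_ν^L` are expressed
through its spatial components `π^{aIJ} = ½ ε_{abc} X_{bc}^{IJ}`, the lapse and the shift. -/
theorem holst_X_ta_decomposition
    (n : Fin 4 → ℝ) (e : Fin 3 → Fin 4 → ℝ)
    (hn : mink n n = -1) (hne : ∀ a : Fin 3, mink n (e a) = 0)
    (q : Matrix (Fin 3) (Fin 3) ℝ)
    (hq : ∀ a b : Fin 3, q a b = mink (e a) (e b))
    (hdetq : 0 < q.det)
    (hdet : (Matrix.of fun (I α : Fin 4) =>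
        (Fin.cons n e : Fin 4 → Fin 4 → ℝ) α I).det = Real.sqrt q.det)
    (N : ℝ) (Nv : Fin 3 → ℝ)
    (et : Fin 4 → ℝ)
    (het : ∀ I, et I = N * n I + ∑ a : Fin 3, Nv a * e a I)
    (X : Fin 4 → Fin 4 → Fin 4 → Fin 4 → ℝ)
    (hX : ∀ μ ν I J : Fin 4, X μ ν I J =
      ∑ M : Fin 4, ∑ N' : Fin 4, ∑ K : Fin 4, ∑ L : Fin 4,
        eta I M * eta J N' * eps4 M N' K L *
          (Fin.cons et e : Fin 4 → Fin 4 → ℝ) μ K *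
          (Fin.cons et e : Fin 4 → Fin 4 → ℝ) ν L)
    (pi : Fin 3 → Fin 4 → Fin 4 → ℝ)
    (hpi : ∀ (a : Fin 3) (I J : Fin 4), pi a I J =
      (1 / 2) * ∑ b : Fin 3, ∑ c : Fin 3, eps3 a b c * X b.succ c.succ I J) :
    ∀ (a : Fin 3) (I J : Fin 4),
      X 0 a.succ I J =
        (∑ b : Fin 3, ∑ c : Fin 3, eps3 a b c * Nv c * pi b I J)
        + (N / Real.sqrt q.det) *
            ∑ b : Fin 3, ∑ c : Fin 3, ∑ K : Fin 4, ∑ L : Fin 4,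
              eps3 a b c * pi b I K * eta K L * pi c L J := by
  open HolstX in
  intro a I J
  have hXs (μ ν : Fin 4) : X μ ν = hodge ((Fin.cons et e : Fin 4 → Fin 4 → ℝ) μ)
      ((Fin.cons et e : Fin 4 → Fin 4 → ℝ) ν) := by
    ext I J
    rw [hX, hodge_apply]
  set F : Matrix (Fin 4) (Fin 4) ℝ := Matrix.of (Fin.cons n e)
  have hF0 : F 0 = n := rfl
  have hFs (b : Fin 3) : F b.succ = e b := rfl
  have hpis (b : Fin 3) : pi b = triadPi F b := by
    ext I J
    simp [hpi, triadPi, hXs, hFs, eps3_eq, Matrix.sum_apply]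
  have hFdet : F.det = Real.sqrt q.det := by
    rw [← hdet, ← Matrix.det_transpose]
    rfl
  have hs : Real.sqrt q.det ≠ 0 := (Real.sqrt_pos.2 hdetq).ne'
  have hFu : IsUnit F := by
    rw [Matrix.isUnit_iff_isUnit_det, hFdet]
    exact hs.isUnit
  have hnormal := congrFun₂ (hodge_normal hFu hn hne a) I J
  have hprod (b c : Fin 3) : (triadPi F b * etaM * triadPi F c) I J =
      ∑ K, ∑ L, triadPi F b I K * eta K L * triadPi F c L J := by
    simp only [Matrix.mul_apply, etaM, Matrix.of_apply, Finset.sum_mul]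
    exact Finset.sum_comm
  simp only [hF0, hFs, hFdet, Matrix.smul_apply, Matrix.sum_apply, smul_eq_mul, hprod] at hnormal
  rw [hXs, Fin.cons_zero, Fin.cons_succ, funext het, hodge_lapse_shift]
  have htri (c : Fin 3) := hodge_triad hFu c a
  simp only [hFs] at htri
  simp only [htri, Matrix.add_apply, Matrix.smul_apply, Matrix.sum_apply, smul_eq_mul,
    hpis, eps3_eq]
  have hsum : ∑ b, ∑ c, ∑ K, ∑ L,
      (lc3 a b c : ℝ) * triadPi F b I K * eta K L * triadPi F c L J =
      Real.sqrt q.det * hodge n (e a) I J := by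
    simp only [hnormal, Finset.mul_sum, mul_assoc]
  rw [hsum, ← mul_assoc, div_mul_cancel₀ _ hs, add_comm, Finset.sum_comm]
  simp only [Finset.mul_sum]
  congr 1
  refine Finset.sum_congr rfl fun _ _ => Finset.sum_congr rfl fun _ _ => ?_
  ring
end

section
/- Let n, e₁, e₂, e₃ ∈ ℝ⁴ satisfy η(n,n) = −1 and η(n,e_a) = 0 for a = 1,2,3, where η is the Minkowski bilinear form. Let N, N¹, N², N³ ∈ ℝ and set e_t := N·n + Σ_a N^a e_a. Let q be the 3×3 Gram matrix q_{ab} = η(e_a,e_b), and let M be the 4×4 matrix with columns e_t, e₁, e₂, e₃. Then (det M)² = N² · det q. -/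
open scoped BigOperators

theorem of_mul_eta_mul_transpose (v : Fin 4 → Fin 4 → ℝ) :
    Matrix.of v * Matrix.of eta * (Matrix.of v).transpose =
      Matrix.of fun α β => mink (v α) (v β) := by
  ext α β
  simp [Matrix.mul_apply, mink, eta, mul_comm]

theorem det_eta : (Matrix.of eta).det = -1 := by
  have h : Matrix.of eta = Matrix.diagonal fun I : Fin 4 => if I = 0 then (-1 : ℝ) else 1 := by
    ext I J
    simp [eta, Matrix.diagonal_apply]
  simp [h, Matrix.det_diagonal]

/-- The squared determinant of a family of four vectors is minus its Minkowski Gram determinant. -/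
theorem det_of_sq (v : Fin 4 → Fin 4 → ℝ) :
    (Matrix.of v).det ^ 2 = -(Matrix.of fun α β => mink (v α) (v β)).det := by
  rw [← of_mul_eta_mul_transpose, Matrix.det_mul, Matrix.det_mul, Matrix.det_transpose, det_eta]
  ring

theorem det_gram_cons_normal (n : Fin 4 → ℝ) (e : Fin 3 → Fin 4 → ℝ)
    (hn : mink n n = -1) (hne : ∀ a : Fin 3, mink n (e a) = 0) :
    (Matrix.of fun α β => mink ((Fin.cons n e : Fin 4 → Fin 4 → ℝ) α)
      ((Fin.cons n e : Fin 4 → Fin 4 → ℝ) β)).det =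
      -(Matrix.of fun a b => mink (e a) (e b)).det := by
  rw [Matrix.det_succ_row_zero, Fin.sum_univ_succ]
  simp only [Matrix.of_apply, Fin.cons_zero, Fin.cons_succ, hn, hne]
  simp [Matrix.submatrix]

/-- Adding to the first row multiples of the others leaves only its component along `n`. -/
theorem det_cons_smul_add_sum (n : Fin 4 → ℝ) (e : Fin 3 → Fin 4 → ℝ) (N : ℝ) (c : Fin 3 → ℝ) :
    (Matrix.of (Fin.cons (fun I => N * n I + ∑ a, c a * e a I) e : Fin 4 → Fin 4 → ℝ)).det =
      N * (Matrix.of (Fin.cons n e : Fin 4 → Fin 4 → ℝ)).det := by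
  let T : Matrix (Fin 4) (Fin 4) ℝ :=
    Matrix.of (Fin.cons (Fin.cons N c : Fin 4 → ℝ) fun a => Pi.single a.succ 1)
  have hT : T.det = N := by
    rw [Matrix.det_of_isUpperTriangular]
    · simp [T, Fin.prod_univ_succ]
    · intro i j hij
      induction i using Fin.cases with
      | zero => exact absurd hij (Fin.not_lt_zero j)
      | succ a => simpa [T] using Pi.single_eq_of_ne (M := fun _ : Fin 4 => ℝ) (ne_of_lt hij) 1
  have hmul : Matrix.of (Fin.cons (fun I => N * n I + ∑ a, c a * e a I) e : Fin 4 → Fin 4 → ℝ) =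
      T * Matrix.of (Fin.cons n e : Fin 4 → Fin 4 → ℝ) := by
    ext α I
    induction α using Fin.cases with
    | zero => simp [T, Matrix.mul_apply, Fin.sum_univ_succ (n := 3)]
    | succ a => simp [T, Matrix.mul_apply, Pi.single_apply]
  rw [hmul, Matrix.det_mul, hT]

/-- With `e_t = N·n + Σ_a Nᵃ e_a`, `n` a unit timelike normal orthogonal to
`e₁,e₂,e₃`, and `q` the spatial Gram matrix, the 4×4 matrix `M` with columns `e_t,e₁,e₂,e₃`
satisfies `(det M)² = N² det q` (the 4-volume element is lapse times spatial volume element). -/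
theorem det_sq_eq_lapse_sq_mul_det_gram
    (n : Fin 4 → ℝ) (e : Fin 3 → Fin 4 → ℝ)
    (hn : mink n n = -1) (hne : ∀ a : Fin 3, mink n (e a) = 0)
    (N : ℝ) (Nv : Fin 3 → ℝ)
    (et : Fin 4 → ℝ)
    (het : ∀ I, et I = N * n I + ∑ a : Fin 3, Nv a * e a I)
    (q : Matrix (Fin 3) (Fin 3) ℝ)
    (hq : ∀ a b : Fin 3, q a b = mink (e a) (e b))
    (M : Matrix (Fin 4) (Fin 4) ℝ)
    (hM : ∀ I α : Fin 4, M I α = (Fin.cons et e : Fin 4 → Fin 4 → ℝ) α I) :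
    M.det ^ 2 = N ^ 2 * q.det := by
  have hM' : M.transpose = Matrix.of
      (Fin.cons (fun I => N * n I + ∑ a, Nv a * e a I) e : Fin 4 → Fin 4 → ℝ) := by
    ext α I
    rw [Matrix.transpose_apply, hM, funext het, Matrix.of_apply]
  have hq' : q = Matrix.of fun a b => mink (e a) (e b) := Matrix.ext hq
  rw [← Matrix.det_transpose, hM', det_cons_smul_add_sum, mul_pow, det_of_sq,
    det_gram_cons_normal n e hn hne, neg_neg, hq']
end

section
/- Let X assign to each ordered pair (μ,ν) with μ,ν ∈ {0,1,2,3} a real array X_{μν}^{IJ} (I,J ∈ {0,1,2,3}), antisymmetric in (μ,ν) (i.e. X_{μν}^{IJ} = −X_{νμ}^{IJ} for all I,J). Define ≺Y,Z≻ := (1/4) Σ_{I,J,K,L} ε_{IJKL} Y^{IJ} Z^{KL}, π^{aIJ} := (1/2) Σ_{b,c∈{1,2,3}} ε_{abc} X_{bc}^{IJ}, β_a^{IJ} := X_{0a}^{IJ}, and 𝒱 := Σ_{μ,ν,ρ,σ} ε_{μνρσ} ≺X_{μν}, X_{ρσ}≻. Then the following are equivalent: (i) for all μ,ν,ρ,σ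 ∈ {0,1,2,3}: ≺X_{μν}, X_{ρσ}≻ = (𝒱/24) ε_{μνρσ}; (ii) for all a,b ∈ {1,2,3}: ≺π^a, π^b≻ = 0, ≺β_a, β_b≻ = 0, and ≺β_a, π^b≻ = (1/3) δ_a^b Σ_{c∈{1,2,3}} ≺β_c, π^c≻. -/
open scoped BigOperators

theorem eps3_eq (a b c : Fin 3) :
    eps3 a b c = (((b : ℤ) - a) * (c - a) * (c - b) : ℤ) / 2 := by
  have h : ∀ a b c : Fin 3, 2 * Matrix.det (Matrix.of fun i j : Fin 3 =>
      if (![a, b, c]) i = j then (1 : ℤ) else 0) = ((b : ℤ) - a) * (c - a) * (c - b) := by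
    simp only [Matrix.det_fin_three, Matrix.of_apply]
    decide
  rw [← h, eps3, Int.cast_mul, Int.cast_det, Int.cast_ofNat, mul_div_cancel_left₀ _ two_ne_zero]
  congr 1
  ext i j
  simp

theorem det_fin_four {R : Type*} [CommRing R] (M : Matrix (Fin 4) (Fin 4) R) :
    M.det =
      M 0 0 * (M 1 1 * (M 2 2 * M 3 3 - M 2 3 * M 3 2) - M 1 2 * (M 2 1 * M 3 3 - M 2 3 * M 3 1)
        + M 1 3 * (M 2 1 * M 3 2 - M 2 2 * M 3 1))
      - M 0 1 * (M 1 0 * (M 2 2 * M 3 3 - M 2 3 * M 3 2) - M 1 2 * (M 2 0 * M 3 3 - M 2 3 * M 3 0)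
        + M 1 3 * (M 2 0 * M 3 2 - M 2 2 * M 3 0))
      + M 0 2 * (M 1 0 * (M 2 1 * M 3 3 - M 2 3 * M 3 1) - M 1 1 * (M 2 0 * M 3 3 - M 2 3 * M 3 0)
        + M 1 3 * (M 2 0 * M 3 1 - M 2 1 * M 3 0))
      - M 0 3 * (M 1 0 * (M 2 1 * M 3 2 - M 2 2 * M 3 1) - M 1 1 * (M 2 0 * M 3 2 - M 2 2 * M 3 0)
        + M 1 2 * (M 2 0 * M 3 1 - M 2 1 * M 3 0)) := by
  have h10 : (1 : Fin 4).succAbove 0 = 0 := rfl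
  have h11 : (1 : Fin 4).succAbove 1 = 2 := rfl
  have h12 : (1 : Fin 4).succAbove 2 = 3 := rfl
  have h20 : (2 : Fin 4).succAbove 0 = 0 := rfl
  have h21 : (2 : Fin 4).succAbove 1 = 1 := rfl
  have h22 : (2 : Fin 4).succAbove 2 = 3 := rfl
  have h30 : (3 : Fin 4).succAbove 0 = 0 := rfl
  have h31 : (3 : Fin 4).succAbove 1 = 1 := rfl
  have h32 : (3 : Fin 4).succAbove 2 = 2 := rfl
  have s2 : (2 : Fin 3).succ = 3 := rfl
  rw [Matrix.det_succ_row_zero, Fin.sum_univ_four]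
  simp [Matrix.det_fin_three, h10, h11, h12, h20, h21, h22, h30, h31, h32, s2]
  ring

theorem eps4_eq (a b c d : Fin 4) :
    eps4 a b c d =
      (((b : ℤ) - a) * (c - a) * (d - a) * (c - b) * (d - b) * (d - c) : ℤ) / 12 := by
  have h : ∀ a b c d : Fin 4, 12 * Matrix.det (Matrix.of fun i j : Fin 4 =>
      if (![a, b, c, d]) i = j then (1 : ℤ) else 0) =
      ((b : ℤ) - a) * (c - a) * (d - a) * (c - b) * (d - b) * (d - c) := by
    simp only [det_fin_four, Matrix.of_apply]
    decide
  rw [← h, eps4, Int.cast_mul, Int.cast_det, Int.cast_ofNat,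
    mul_div_cancel_left₀ _ (by norm_num)]
  congr 1
  ext i j
  simp

theorem sum_comm_pairs {ι R : Type*} [Fintype ι] [AddCommMonoid R] (f : ι → ι → ι → ι → R) :
    ∑ I, ∑ J, ∑ K, ∑ L, f I J K L = ∑ I, ∑ J, ∑ K, ∑ L, f K L I J := by
  have h := Finset.sum_comm (s := Finset.univ) (t := Finset.univ)
    (f := fun p q : ι × ι => f p.1 p.2 q.1 q.2)
  simpa only [Fintype.sum_prod_type] using h

theorem eps4_swap_pairs (a b c d : Fin 4) : eps4 a b c d = eps4 c d a b := by
  rw [eps4_eq, eps4_eq]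
  push_cast
  ring

/-- For an antisymmetric two-form field `X_{μν}^{IJ}`, the Plebanski
simplicity constraint `≺X_{μν},X_{ρσ}≻ = (𝒱/24) ε_{μνρσ}` is equivalent to the canonical
constraints: `≺πᵃ,πᵇ≻ = 0`, `≺β_a,β_b≻ = 0`, and `≺β_a,πᵇ≻ = (1/3)δ_aᵇ Σ_c ≺β_c,πᶜ≻`. -/
theorem simplicity_constraint_canonical_decomposition
    (X : Fin 4 → Fin 4 → Fin 4 → Fin 4 → ℝ)
    (hanti : ∀ (μ ν I J : Fin 4), X μ ν I J = - X ν μ I J)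
    (prec : (Fin 4 → Fin 4 → ℝ) → (Fin 4 → Fin 4 → ℝ) → ℝ)
    (hprec : ∀ Y Z, prec Y Z =
      (1 / 4) * ∑ I : Fin 4, ∑ J : Fin 4, ∑ K : Fin 4, ∑ L : Fin 4,
        eps4 I J K L * Y I J * Z K L)
    (pi : Fin 3 → Fin 4 → Fin 4 → ℝ)
    (hpi : ∀ (a : Fin 3) (I J : Fin 4), pi a I J =
      (1 / 2) * ∑ b : Fin 3, ∑ c : Fin 3, eps3 a b c * X b.succ c.succ I J)
    (β : Fin 3 → Fin 4 → Fin 4 → ℝ)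
    (hβ : ∀ a : Fin 3, β a = X 0 a.succ)
    (V : ℝ)
    (hV : V = ∑ μ : Fin 4, ∑ ν : Fin 4, ∑ ρ : Fin 4, ∑ σ : Fin 4,
      eps4 μ ν ρ σ * prec (X μ ν) (X ρ σ)) :
    (∀ μ ν ρ σ : Fin 4, prec (X μ ν) (X ρ σ) = V / 24 * eps4 μ ν ρ σ)
      ↔ (∀ a b : Fin 3,
          prec (pi a) (pi b) = 0 ∧
          prec (β a) (β b) = 0 ∧
          prec (β a) (pi b) =
            (1 / 3) * (if a = b then (1 : ℝ) else 0) * ∑ c : Fin 3, prec (β c) (pi c)) := by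
  have sym : ∀ Y Z, prec Y Z = prec Z Y := by
    intro Y Z
    rw [hprec, hprec]
    rw [sum_comm_pairs]
    congr! 5 with I _ J _ K _ L
    rw [eps4_swap_pairs, mul_right_comm]
  have neg_left : ∀ Y Z, prec (-Y) Z = -prec Y Z := by
    intro Y Z
    simp [hprec]
  have neg_right : ∀ Y Z, prec Y (-Z) = -prec Y Z := by
    intro Y Z
    rw [sym, neg_left, sym]
  have zero_left : ∀ Z, prec 0 Z = 0 := by
    intro Z
    simp [hprec]
  have zero_right : ∀ Y, prec Y 0 = 0 := by
    intro Y
    rw [sym, zero_left]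
  have anti : ∀ μ ν, X μ ν = -X ν μ := by
    intro μ ν
    ext I J
    exact hanti μ ν I J
  have diag : ∀ μ, X μ μ = 0 := fun μ => self_eq_neg.mp (anti μ μ)
  have hβ0 : X 0 1 = β 0 := (hβ 0).symm
  have hβ1 : X 0 2 = β 1 := (hβ 1).symm
  have hβ2 : X 0 3 = β 2 := (hβ 2).symm
  have hπ0 : X 2 3 = pi 0 := by
    ext I J
    have := hanti 2 3 I J
    simp [hpi, Fin.sum_univ_three, eps3_eq, show (2 : Fin 3).succ = 3 from rfl]
    linarith
  have hπ1 : X 1 3 = -pi 1 := by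
    ext I J
    have := hanti 1 3 I J
    simp [hpi, Fin.sum_univ_three, eps3_eq, show (2 : Fin 3).succ = 3 from rfl]
    linarith
  have hπ2 : X 1 2 = pi 2 := by
    ext I J
    have := hanti 1 2 I J
    simp [hpi, Fin.sum_univ_three, eps3_eq, show (2 : Fin 3).succ = 3 from rfl]
    linarith
  have h10 : X 1 0 = -β 0 := by rw [anti, hβ0]
  have h20 : X 2 0 = -β 1 := by rw [anti, hβ1]
  have h30 : X 3 0 = -β 2 := by rw [anti, hβ2]
  have h21 : X 2 1 = -pi 2 := by rw [anti, hπ2]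
  have h31 : X 3 1 = pi 1 := by rw [anti, hπ1, neg_neg]
  have h32 : X 3 2 = -pi 0 := by rw [anti, hπ0]
  have hV' : V = 8 * ∑ c : Fin 3, prec (β c) (pi c) := by
    rw [hV]
    simp only [Fin.sum_univ_four, Fin.sum_univ_three, eps4_eq, diag, hβ0, hβ1, hβ2, hπ0, hπ1,
      hπ2, h10, h20, h30, h21, h31, h32, neg_left, neg_right, zero_left, zero_right,
      sym (pi _) (β _)]
    norm_num
    ring
  constructor
  · intro h a b
    fin_cases a <;> fin_cases b <;>
    simp [← hβ0, ← hβ1, ← hβ2, ← hπ0, ← h31, ← hπ2, Fin.sum_univ_three, h, eps4_eq] <;> ring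
  · intro h
    have hππ a b := (h a b).1
    have hββ a b := (h a b).2.1
    have hβπ a b := (h a b).2.2
    have hS : ∑ c : Fin 3, prec (β c) (pi c) = V / 8 := by linarith
    simp only [hS] at hβπ
    intro μ ν ρ σ
    fin_cases μ <;> fin_cases ν <;> fin_cases ρ <;> fin_cases σ <;>
    simp [eps4_eq, diag, hβ0, hβ1, hβ2, hπ0, hπ1,
      hπ2, h10, h20, h30, h21, h31, h32, neg_left, neg_right, zero_left, zero_right,
      sym (pi _) (β _), hππ, hββ, hβπ] <;> ring
end

section
/- Let Q be a real symmetric 3×3 matrix. The linear endomorphism T of the real vector space Sym₃(ℝ) of symmetric 3×3 real matrices defined by T(S) := (tr(Q·S))·Q − Q·S·Q has determinant det T = −2 (det Q)⁴. -/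
open scoped BigOperators

/-- The real vector space `Sym₃(ℝ)` of symmetric 3×3 real matrices, as a submodule of
`Matrix (Fin 3) (Fin 3) ℝ`. -/
def Sym3 : Submodule ℝ (Matrix (Fin 3) (Fin 3) ℝ) where
  carrier := {A | A.IsSymm}
  add_mem' := fun ha hb => Matrix.IsSymm.add ha hb
  zero_mem' := Matrix.isSymm_zero
  smul_mem' := fun c _ ha => Matrix.IsSymm.smul ha c

/-- Congruence `S ↦ U S Uᵀ` by an orthogonal matrix, as an automorphism of `Sym₃(ℝ)`. -/
def Sym3.congruence (U : Matrix (Fin 3) (Fin 3) ℝ) (hU : U.transpose * U = 1) :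
    Sym3 ≃ₗ[ℝ] Sym3 where
  toFun S := ⟨U * S.1 * U.transpose, by
    have hS : S.1.transpose = S.1 := S.2
    change (U * S.1 * U.transpose).transpose = _
    simp [Matrix.transpose_mul, hS, Matrix.mul_assoc]⟩
  invFun S := ⟨U.transpose * S.1 * U, by
    have hS : S.1.transpose = S.1 := S.2
    change (U.transpose * S.1 * U).transpose = _
    simp [Matrix.transpose_mul, hS, Matrix.mul_assoc]⟩
  map_add' S R := Subtype.ext (by simp [Matrix.mul_add, Matrix.add_mul])
  map_smul' c S := Subtype.ext (by simp)
  left_inv S := Subtype.ext <| by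
    calc U.transpose * (U * S.1 * U.transpose) * U
        = (U.transpose * U) * S.1 * (U.transpose * U) := by simp only [Matrix.mul_assoc]
      _ = S.1 := by simp [hU]
  right_inv S := Subtype.ext <| by
    have hU' : U * U.transpose = 1 := mul_eq_one_comm.mp hU
    calc U * (U.transpose * S.1 * U) * U.transpose
        = (U * U.transpose) * S.1 * (U * U.transpose) := by simp only [Matrix.mul_assoc]
      _ = S.1 := by simp [hU']

/-- The diagonal and off-diagonal coordinates of a symmetric 3×3 matrix. -/
def Sym3.coordinates : Sym3 ≃ₗ[ℝ] (Fin 3 → ℝ) × (Fin 3 → ℝ) where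
  toFun S := (![S.1 0 0, S.1 1 1, S.1 2 2], ![S.1 1 2, S.1 0 2, S.1 0 1])
  invFun v := ⟨!![v.1 0, v.2 2, v.2 1; v.2 2, v.1 1, v.2 0; v.2 1, v.2 0, v.1 2], by
    change Matrix.transpose _ = _
    ext i j
    fin_cases i <;> fin_cases j <;> rfl⟩
  map_add' S R := by ext i <;> fin_cases i <;> rfl
  map_smul' c S := by ext i <;> fin_cases i <;> rfl
  left_inv S := Subtype.ext <| by
    have hS : S.1.IsSymm := S.2
    ext i j
    fin_cases i <;> fin_cases j
    exacts [rfl, rfl, rfl, hS.apply 1 0, rfl, rfl, hS.apply 2 0, hS.apply 2 1, rfl]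
  right_inv v := by ext i <;> fin_cases i <;> rfl

theorem det_dirac_endo_diagonal (d : Fin 3 → ℝ) (T : Sym3 →ₗ[ℝ] Sym3)
    (hT : ∀ S : Sym3, (T S : Matrix (Fin 3) (Fin 3) ℝ) =
      (Matrix.diagonal d * S.1).trace • Matrix.diagonal d
        - Matrix.diagonal d * S.1 * Matrix.diagonal d) :
    LinearMap.det T = -2 * (Matrix.diagonal d).det ^ 4 := by
  have h : (Sym3.coordinates : Sym3 →ₗ[ℝ] _) ∘ₗ T ∘ₗ
      (Sym3.coordinates.symm : _ →ₗ[ℝ] Sym3) =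
      (Matrix.toLin' !![0, d 0 * d 1, d 0 * d 2; d 0 * d 1, 0, d 1 * d 2;
        d 0 * d 2, d 1 * d 2, 0]).prodMap
      (Matrix.toLin' (Matrix.diagonal ![-(d 1 * d 2), -(d 0 * d 2), -(d 0 * d 1)])) := by
    refine LinearMap.ext fun v => ?_
    ext i <;> fin_cases i <;>
      simp [Sym3.coordinates, hT, Matrix.trace, Fin.sum_univ_three, Matrix.mulVec,
        dotProduct, Matrix.diagonal_apply] <;> ring
  rw [← LinearMap.det_conj T Sym3.coordinates, h, LinearMap.det_prodMap, LinearMap.det_toLin',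
    LinearMap.det_toLin', Matrix.det_fin_three, Matrix.det_diagonal, Matrix.det_diagonal]
  simp [Fin.prod_univ_three]
  ring

/-- For a real symmetric 3×3 matrix `Q`, the linear endomorphism
`S ↦ tr(Q·S)·Q − Q·S·Q` of `Sym₃(ℝ)` has determinant `−2 (det Q)⁴`. -/
theorem det_dirac_matrix_endo (Q : Matrix (Fin 3) (Fin 3) ℝ) (hQ : Q.IsSymm)
    (T : Sym3 →ₗ[ℝ] Sym3)
    (hT : ∀ S : Sym3, (T S : Matrix (Fin 3) (Fin 3) ℝ) =
      Matrix.trace (Q * (S : Matrix (Fin 3) (Fin 3) ℝ)) • Q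
        - Q * (S : Matrix (Fin 3) (Fin 3) ℝ) * Q) :
    LinearMap.det T = -2 * Q.det ^ 4 := by
  have hH : Q.IsHermitian := by
    rw [Matrix.IsHermitian, Matrix.conjTranspose_eq_transpose_of_trivial]
    exact hQ
  obtain ⟨U, d, hU, hQU⟩ : ∃ (U : Matrix (Fin 3) (Fin 3) ℝ) (d : Fin 3 → ℝ),
      U.transpose * U = 1 ∧ Q = U * Matrix.diagonal d * U.transpose := by
    refine ⟨hH.eigenvectorUnitary, hH.eigenvalues, ?_, ?_⟩
    · simpa [Matrix.star_eq_conjTranspose] using Unitary.coe_star_mul_self hH.eigenvectorUnitary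
    · simpa [Unitary.conjStarAlgAut_apply, Matrix.star_eq_conjTranspose, Function.comp_def]
        using hH.spectral_theorem
  have hdet : Q.det = (Matrix.diagonal d).det := by
    rw [hQU, Matrix.det_mul_right_comm, mul_eq_one_comm.mp hU, one_mul]
  rw [hdet, ← LinearMap.det_conj T (Sym3.congruence U hU).symm]
  refine det_dirac_endo_diagonal d _ fun S => ?_
  have htr : (Q * (U * S.1 * U.transpose)).trace = (Matrix.diagonal d * S.1).trace := by
    calc (Q * (U * S.1 * U.transpose)).trace
        = (U * (Matrix.diagonal d * (U.transpose * U) * S.1 * U.transpose)).trace := by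
          simp only [hQU, Matrix.mul_assoc]
      _ = (Matrix.diagonal d * S.1 * (U.transpose * U)).trace := by
          rw [hU, Matrix.trace_mul_comm]
          simp only [Matrix.mul_assoc, Matrix.mul_one, hU]
      _ = _ := by rw [hU, Matrix.mul_one]
  have hconj : U.transpose * Q * U = Matrix.diagonal d := by
    calc U.transpose * Q * U
        = (U.transpose * U) * Matrix.diagonal d * (U.transpose * U) := by
          simp only [hQU, Matrix.mul_assoc]
      _ = _ := by simp [hU]
  change U.transpose * (T (Sym3.congruence U hU S)).1 * U = _
  rw [hT]
  change U.transpose * ((Q * (U * S.1 * U.transpose)).trace • Q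
    - Q * (U * S.1 * U.transpose) * Q) * U = _
  rw [htr, ← hconj]
  simp only [Matrix.mul_sub, Matrix.sub_mul, Matrix.mul_smul, Matrix.smul_mul, Matrix.mul_assoc]
end

section
/- Let q be a real symmetric positive-definite 3×3 matrix. The linear endomorphism T of the real vector space Sym₃(ℝ) of symmetric 3×3 real matrices defined by T(S) := (det q)^{3/2} · ( (tr(q⁻¹·S))·q⁻¹ − q⁻¹·S·q⁻¹ ) has determinant det T = −2 (det q)⁵. -/
open scoped BigOperators

open Matrix

/-- The congruence `S ↦ U S Uᵀ` of symmetric matrices by an orthogonal matrix `U`. -/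
def Sym3.congr (U : Matrix (Fin 3) (Fin 3) ℝ) (h : Uᵀ * U = 1) : Sym3 ≃ₗ[ℝ] Sym3 where
  toFun S := ⟨U * (S : Matrix (Fin 3) (Fin 3) ℝ) * Uᵀ, by
    have hS : (S : Matrix (Fin 3) (Fin 3) ℝ)ᵀ = S := S.2
    change (_ : Matrix (Fin 3) (Fin 3) ℝ)ᵀ = _
    simp [Matrix.transpose_mul, hS, Matrix.mul_assoc]⟩
  map_add' S S' := by
    ext1
    simp [Matrix.mul_add, Matrix.add_mul]
  map_smul' c S := by
    ext1
    simp
  invFun S := ⟨Uᵀ * (S : Matrix (Fin 3) (Fin 3) ℝ) * U, by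
    have hS : (S : Matrix (Fin 3) (Fin 3) ℝ)ᵀ = S := S.2
    change (_ : Matrix (Fin 3) (Fin 3) ℝ)ᵀ = _
    simp [Matrix.transpose_mul, hS, Matrix.mul_assoc]⟩
  left_inv S := by
    ext1
    calc Uᵀ * (U * (S : Matrix (Fin 3) (Fin 3) ℝ) * Uᵀ) * U
        = (Uᵀ * U) * S * (Uᵀ * U) := by simp only [Matrix.mul_assoc]
      _ = S := by simp [h]
  right_inv S := by
    have h' : U * Uᵀ = 1 := mul_eq_one_comm.mp h
    ext1
    calc U * (Uᵀ * (S : Matrix (Fin 3) (Fin 3) ℝ) * U) * Uᵀ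
        = (U * Uᵀ) * S * (U * Uᵀ) := by simp only [Matrix.mul_assoc]
      _ = S := by simp [h']

/-- The diagonal entries, followed by the off-diagonal ones, as coordinates on `Sym₃(ℝ)`. -/
def Sym3.coords : Sym3 ≃ₗ[ℝ] (Fin 3 ⊕ Fin 3 → ℝ) where
  toFun S := Sum.elim ![S.1 0 0, S.1 1 1, S.1 2 2] ![S.1 1 2, S.1 0 2, S.1 0 1]
  map_add' S S' := by
    ext (i | i) <;> fin_cases i <;> simp
  map_smul' c S := by
    ext (i | i) <;> fin_cases i <;> simp
  invFun v := ⟨!![v (.inl 0), v (.inr 2), v (.inr 1);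
                  v (.inr 2), v (.inl 1), v (.inr 0);
                  v (.inr 1), v (.inr 0), v (.inl 2)], by
    change (_ : Matrix (Fin 3) (Fin 3) ℝ)ᵀ = _
    ext i j
    fin_cases i <;> fin_cases j <;> rfl⟩
  left_inv S := by
    have hS : ∀ i j, S.1 i j = S.1 j i := fun i j => Matrix.IsSymm.apply S.2 j i
    ext i j
    fin_cases i <;> fin_cases j <;> simp [hS 1 0, hS 2 0, hS 2 1]
  right_inv v := by
    ext (i | i) <;> fin_cases i <;> rfl

/-- The determinant of `S ↦ c (tr(D S) D - D S D)` for a diagonal matrix `D`. -/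
theorem Sym3.det_of_diagonal (c : ℝ) (a : Fin 3 → ℝ) (T : Sym3 →ₗ[ℝ] Sym3)
    (hT : ∀ S : Sym3, (T S : Matrix (Fin 3) (Fin 3) ℝ) =
      c • (Matrix.trace (diagonal a * (S : Matrix (Fin 3) (Fin 3) ℝ)) • diagonal a
          - diagonal a * (S : Matrix (Fin 3) (Fin 3) ℝ) * diagonal a)) :
    LinearMap.det T = -2 * c ^ 6 * (a 0 * a 1 * a 2) ^ 4 := by
  have hM : LinearMap.toMatrix (Module.Basis.ofEquivFun Sym3.coords)
      (Module.Basis.ofEquivFun Sym3.coords) T = fromBlocks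
        (!![0, c * (a 0 * a 1), c * (a 0 * a 2);
            c * (a 0 * a 1), 0, c * (a 1 * a 2);
            c * (a 0 * a 2), c * (a 1 * a 2), 0]) 0 0
        (diagonal ![-(c * (a 1 * a 2)), -(c * (a 0 * a 2)), -(c * (a 0 * a 1))]) := by
    ext (i | i) (j | j) <;> fin_cases i <;> fin_cases j <;>
      simp [LinearMap.toMatrix_apply, Sym3.coords, hT, Matrix.trace, Fin.sum_univ_three,
        diagonal_mul, mul_diagonal, -mul_eq_mul_left_iff] <;> ring
  rw [← LinearMap.det_toMatrix (Module.Basis.ofEquivFun Sym3.coords), hM,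
    det_fromBlocks_zero₂₁, det_fin_three, det_diagonal]
  simp [Fin.prod_univ_three]
  ring

/-- For a real symmetric positive-definite 3×3 matrix `q`, the linear
endomorphism `S ↦ (det q)^{3/2}·(tr(q⁻¹·S)·q⁻¹ − q⁻¹·S·q⁻¹)` of `Sym₃(ℝ)` has determinant
`−2 (det q)⁵`.  This is the determinant of the Dirac matrix of second-class constraints in the
Holst canonical theory, giving the local measure factor `(det q)⁵ = V_s^{10}`. -/
theorem det_dirac_matrix_posdef (q : Matrix (Fin 3) (Fin 3) ℝ) (hq : q.PosDef)
    (T : Sym3 →ₗ[ℝ] Sym3)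
    (hT : ∀ S : Sym3, (T S : Matrix (Fin 3) (Fin 3) ℝ) =
      q.det ^ ((3 : ℝ) / 2) •
        (Matrix.trace (q⁻¹ * (S : Matrix (Fin 3) (Fin 3) ℝ)) • q⁻¹
          - q⁻¹ * (S : Matrix (Fin 3) (Fin 3) ℝ) * q⁻¹)) :
    LinearMap.det T = -2 * q.det ^ 5 := by
  have hd : 0 < q.det := hq.det_pos
  obtain ⟨U, a, hU, hqU⟩ : ∃ (U : Matrix (Fin 3) (Fin 3) ℝ) (a : Fin 3 → ℝ),
      Uᵀ * U = 1 ∧ q⁻¹ = U * diagonal a * Uᵀ := by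
    have h := hq.inv.1
    refine ⟨h.eigenvectorUnitary, h.eigenvalues, ?_, ?_⟩
    · simpa [star_eq_conjTranspose] using Unitary.coe_star_mul_self h.eigenvectorUnitary
    · simpa [Unitary.conjStarAlgAut_apply, star_eq_conjTranspose, Function.comp_def]
        using h.spectral_theorem
  have hU' : U * Uᵀ = 1 := mul_eq_one_comm.mp hU
  have ha : a 0 * a 1 * a 2 = q.det⁻¹ := by
    have h1 : q⁻¹.det = q.det⁻¹ := by
      rw [det_nonsing_inv, Ring.inverse_eq_inv']
    rw [← h1, hqU, det_mul_right_comm, hU', one_mul, det_diagonal, Fin.prod_univ_three]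
  have hpow : (q.det ^ ((3 : ℝ) / 2)) ^ 6 = q.det ^ 9 := by
    rw [← Real.rpow_natCast, ← Real.rpow_mul hd.le, ← Real.rpow_natCast]
    norm_num
  rw [← LinearMap.det_conj T (Sym3.congr U hU).symm,
    Sym3.det_of_diagonal (q.det ^ ((3 : ℝ) / 2)) a _ ?_, hpow, ha]
  · field_simp
  · intro S
    set D := diagonal a
    set M : Matrix (Fin 3) (Fin 3) ℝ := S.1
    have hc : ∀ X : Matrix (Fin 3) (Fin 3) ℝ, Uᵀ * (U * X) = X := fun X => by
      rw [← Matrix.mul_assoc, hU, Matrix.one_mul]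
    have htr : trace (q⁻¹ * (U * M * Uᵀ)) = trace (D * M) := by
      rw [hqU, Matrix.trace_mul_comm]
      simp only [Matrix.mul_assoc, hc]
      rw [Matrix.trace_mul_comm]
      simp only [Matrix.mul_assoc, hU, Matrix.mul_one]
      rw [Matrix.trace_mul_comm]
    change Uᵀ * (T (Sym3.congr U hU S) : Matrix (Fin 3) (Fin 3) ℝ) * U = _
    rw [hT]
    change Uᵀ * (_ • (trace (q⁻¹ * (U * M * Uᵀ)) • q⁻¹ - q⁻¹ * (U * M * Uᵀ) * q⁻¹)) * U = _
    rw [htr, hqU]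
    simp only [Matrix.mul_smul, Matrix.smul_mul, Matrix.mul_sub, Matrix.sub_mul,
      Matrix.mul_assoc, hc, hU, Matrix.mul_one]
end

section
/- Let D := {e ∈ M₃(ℝ) : det e > 0}. Define Φ : D × ℝ³ × Sym₃(ℝ) → M₃(ℝ) × M₃(ℝ) by Φ(e, w, S) := ( (det e)·e⁻¹ , (S + W(w))ᵀ · eᵀ ), where W(w) is the antisymmetric 3×3 matrix with entries W(w)_{b,c} := Σ_{d∈{1,2,3}} ε_{bcd} w_d. Then Φ is injective and its image is exactly {(π, π̃) ∈ M₃(ℝ) × M₃(ℝ) : det π > 0}. -/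
open scoped BigOperators
open Matrix

/-- The antisymmetric 3×3 matrix `W(w)_{b,c} = Σ_d ε_{bcd} w_d` associated to `w ∈ ℝ³`. -/
noncomputable def Wmat (w : Fin 3 → ℝ) : Matrix (Fin 3) (Fin 3) ℝ :=
  Matrix.of fun b c => ∑ d : Fin 3, eps3 b c d * w d

/-- The coordinate change `Φ(e, w, S) := ((det e)·e⁻¹, (S + W(w))ᵀ·eᵀ)` on the sector of
positively oriented co-triads. -/
noncomputable def Phi :
    {e : Matrix (Fin 3) (Fin 3) ℝ // 0 < e.det} × (Fin 3 → ℝ) × Sym3 →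
      Matrix (Fin 3) (Fin 3) ℝ × Matrix (Fin 3) (Fin 3) ℝ :=
  fun p =>
    ((p.1.1).det • (p.1.1)⁻¹,
      ((p.2.2 : Matrix (Fin 3) (Fin 3) ℝ) + Wmat p.2.1)ᵀ * (p.1.1)ᵀ)

theorem Wmat_eq (w : Fin 3 → ℝ) :
    Wmat w = !![0, w 2, -w 1; -w 2, 0, w 0; w 1, -w 0, 0] := by
  ext b c
  fin_cases b <;> fin_cases c <;>
    simp [Wmat, eps3, Fin.sum_univ_three, Matrix.det_fin_three]

theorem Wmat_transpose (w : Fin 3 → ℝ) : (Wmat w)ᵀ = -Wmat w := by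
  rw [Wmat_eq]
  ext b c
  fin_cases b <;> fin_cases c <;> simp

theorem Wmat_injective : Function.Injective Wmat := by
  intro v w h
  rw [Wmat_eq, Wmat_eq] at h
  ext i
  fin_cases i
  · simpa using congrFun₂ h 1 2
  · simpa using congrFun₂ h 2 0
  · simpa using congrFun₂ h 0 1

theorem add_Wmat_injective {S T : Matrix (Fin 3) (Fin 3) ℝ} (hS : S.IsSymm) (hT : T.IsSymm)
    {v w : Fin 3 → ℝ} (h : S + Wmat v = T + Wmat w) : S = T ∧ v = w := by
  have ht := congrArg Matrix.transpose h
  rw [Matrix.transpose_add, Matrix.transpose_add, hS.eq, hT.eq, Wmat_transpose,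
    Wmat_transpose] at ht
  have hST : S = T := by
    ext i j
    have h₁ := congrFun₂ h i j
    have h₂ := congrFun₂ ht i j
    simp only [Matrix.add_apply, Matrix.neg_apply] at h₁ h₂
    linarith
  subst hST
  exact ⟨rfl, Wmat_injective (add_left_cancel h)⟩

theorem exists_isSymm_add_Wmat (X : Matrix (Fin 3) (Fin 3) ℝ) :
    ∃ S : Matrix (Fin 3) (Fin 3) ℝ, S.IsSymm ∧ ∃ w, S + Wmat w = X := by
  refine ⟨(1 / 2 : ℝ) • (X + Xᵀ), (Matrix.isSymm_add_transpose_self X).smul _,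
    ![(X 1 2 - X 2 1) / 2, (X 2 0 - X 0 2) / 2, (X 0 1 - X 1 0) / 2], ?_⟩
  rw [Wmat_eq]
  ext i j
  fin_cases i <;> fin_cases j <;> simp <;> ring

theorem det_smul_inv_eq_adjugate {A : Matrix (Fin 3) (Fin 3) ℝ} (h : A.det ≠ 0) :
    A.det • A⁻¹ = A.adjugate := by
  rw [Matrix.inv_def, smul_smul, Ring.inverse_eq_inv', mul_inv_cancel₀ h, one_smul]

theorem adjugate_adjugate_fin_three (A : Matrix (Fin 3) (Fin 3) ℝ) :
    A.adjugate.adjugate = A.det • A := by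
  rw [Matrix.adjugate_adjugate A (by simp)]
  simp

theorem adjugate_injOn_det_pos :
    Set.InjOn Matrix.adjugate {A : Matrix (Fin 3) (Fin 3) ℝ | 0 < A.det} := by
  intro A hA B hB h
  rw [Set.mem_ofPred_eq] at hA hB
  have hdet : A.det = B.det := by
    have h₁ := congrArg Matrix.det h
    rw [Matrix.det_adjugate, Matrix.det_adjugate] at h₁
    exact (pow_left_inj₀ hA.le hB.le (by simp)).mp h₁
  have h₂ := congrArg Matrix.adjugate h
  rw [adjugate_adjugate_fin_three, adjugate_adjugate_fin_three, ← hdet] at h₂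
  exact smul_right_injective _ hA.ne' h₂

theorem exists_det_pos_adjugate_eq {P : Matrix (Fin 3) (Fin 3) ℝ} (hP : 0 < P.det) :
    ∃ A : Matrix (Fin 3) (Fin 3) ℝ, 0 < A.det ∧ A.adjugate = P := by
  refine ⟨(√P.det)⁻¹ • P.adjugate, ?_, ?_⟩
  · rw [Matrix.det_smul, Matrix.det_adjugate]
    positivity
  · rw [Matrix.adjugate_smul, adjugate_adjugate_fin_three, smul_smul]
    simp [Real.sq_sqrt hP.le, hP.ne']

/-- The map `Φ(e, w, S) = ((det e)·e⁻¹, (S + W(w))ᵀ·eᵀ)`, defined on triples of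
a 3×3 matrix `e` with `det e > 0`, a vector `w ∈ ℝ³` and a symmetric matrix `S`, is injective
and its image is exactly the set of pairs `(π, π̃)` of 3×3 matrices with `det π > 0`. -/
theorem phi_injective_and_range :
    Function.Injective Phi ∧
      Set.range Phi =
        {p : Matrix (Fin 3) (Fin 3) ℝ × Matrix (Fin 3) (Fin 3) ℝ | 0 < p.1.det} := by
  constructor
  · rintro ⟨⟨e, he⟩, v, ⟨S, hS⟩⟩ ⟨⟨f, hf⟩, w, ⟨T, hT⟩⟩ h
    simp only [Phi, Prod.mk.injEq, det_smul_inv_eq_adjugate he.ne',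
      det_smul_inv_eq_adjugate hf.ne', ← Matrix.transpose_mul] at h
    obtain ⟨h₁, h₂⟩ := h
    obtain rfl := adjugate_injOn_det_pos he hf h₁
    have hu : IsUnit e := (Matrix.isUnit_iff_isUnit_det e).mpr he.ne'.isUnit
    obtain ⟨rfl, rfl⟩ :=
      add_Wmat_injective hS hT (hu.mul_left_cancel (Matrix.transpose_injective h₂))
    rfl
  · ext ⟨P, Q⟩
    constructor
    · rintro ⟨⟨⟨e, he⟩, w, S⟩, h⟩
      obtain ⟨rfl, -⟩ := Prod.mk.inj h
      change 0 < (e.det • e⁻¹).det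
      rw [det_smul_inv_eq_adjugate he.ne', Matrix.det_adjugate]
      positivity
    · intro hP
      obtain ⟨e, he, rfl⟩ := exists_det_pos_adjugate_eq hP
      obtain ⟨S, hS, w, hw⟩ := exists_isSymm_add_Wmat (e⁻¹ * Qᵀ)
      refine ⟨⟨⟨e, he⟩, w, ⟨S, hS⟩⟩, ?_⟩
      simp only [Phi, det_smul_inv_eq_adjugate he.ne', ← Matrix.transpose_mul, hw]
      rw [Matrix.mul_nonsing_inv_cancel_left _ _ he.ne'.isUnit, Matrix.transpose_transpose]
end

section
/- Fix an invertible real 3×3 matrix E with entries e^i_a, and a vector u ∈ ℝ³ with entries u_a. The map from ℝ³ × ℝ × Sym₃(ℝ) × {L ∈ M₃(ℝ) : tr L = 0} to M₃(ℝ) × M₃(ℝ) sending (v, v⁰, C, L) to (β, β̃), where β^i_a := Σ_{j,k} ε_{ijk} v^k e^j_a + Σ_j C^{ij} e^j_a and β̃^i_a := Σ_b e^i_b L^b_a + e^i_a v⁰ − u_a v^i, is a linear isomorphism onto M₃(ℝ) × M₃(ℝ). -/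
open scoped BigOperators
open Matrix

/-- The real vector space of trace-free 3×3 real matrices, as a submodule of
`Matrix (Fin 3) (Fin 3) ℝ`. -/
def Tr0 : Submodule ℝ (Matrix (Fin 3) (Fin 3) ℝ) :=
  LinearMap.ker (Matrix.traceLinearMap (Fin 3) ℝ ℝ)

/-- The skew-symmetric matrix `A_{ij} = Σ_k ε_{ijk} v^k` dual to the vector `v`. -/
def skewOfVec (v : Fin 3 → ℝ) : Matrix (Fin 3) (Fin 3) ℝ :=
  !![0, v 2, -v 1; -v 2, 0, v 0; v 1, -v 0, 0]

theorem sum_eps3_mul (v : Fin 3 → ℝ) (i j : Fin 3) :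
    ∑ k : Fin 3, eps3 i j k * v k = skewOfVec v i j := by
  fin_cases i <;> fin_cases j <;>
    simp [eps3, skewOfVec, Fin.sum_univ_three, Matrix.det_fin_three]

/-- The splitting of a matrix into its skew-symmetric and symmetric parts is unique. -/
theorem eq_zero_of_skewOfVec_add_eq_zero {v : Fin 3 → ℝ} {C : Matrix (Fin 3) (Fin 3) ℝ}
    (hC : C.IsSymm) (h : skewOfVec v + C = 0) : v = 0 ∧ C = 0 := by
  have hv : v = 0 := by
    have key : ∀ i j, skewOfVec v i j + C i j = 0 := fun i j => congrFun (congrFun h i) j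
    have h01 := key 0 1
    have h10 := key 1 0
    have h02 := key 0 2
    have h20 := key 2 0
    have h12 := key 1 2
    have h21 := key 2 1
    rw [hC.apply 0 1] at h10
    rw [hC.apply 0 2] at h20
    rw [hC.apply 1 2] at h21
    simp only [skewOfVec, of_apply, cons_val', cons_val] at h01 h10 h02 h20 h12 h21
    ext k
    fin_cases k <;> simp <;> linarith
  subst hv
  have h0 : skewOfVec 0 = 0 := by
    ext i j
    fin_cases i <;> fin_cases j <;> simp [skewOfVec]
  exact ⟨rfl, by simpa [h0] using h⟩

theorem exists_skewOfVec_add_eq (M : Matrix (Fin 3) (Fin 3) ℝ) :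
    ∃ (v : Fin 3 → ℝ) (C : Sym3), skewOfVec v + (C : Matrix (Fin 3) (Fin 3) ℝ) = M := by
  refine ⟨![(M 1 2 - M 2 1) / 2, (M 2 0 - M 0 2) / 2, (M 0 1 - M 1 0) / 2],
    ⟨(1 / 2 : ℝ) • (M + Mᵀ), (isSymm_add_transpose_self M).smul _⟩, ?_⟩
  ext i j
  fin_cases i <;> fin_cases j <;> simp [skewOfVec] <;> ring

theorem eq_zero_of_add_smul_one_eq_zero {L : Matrix (Fin 3) (Fin 3) ℝ} {c : ℝ}
    (hL : L.trace = 0) (h : L + c • (1 : Matrix (Fin 3) (Fin 3) ℝ) = 0) : c = 0 ∧ L = 0 := by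
  have hc : c = 0 := by
    have := congrArg Matrix.trace h
    simpa [hL] using this
  subst hc
  exact ⟨rfl, by simpa using h⟩

theorem exists_add_smul_one_eq (N : Matrix (Fin 3) (Fin 3) ℝ) :
    ∃ (c : ℝ) (L : Tr0),
      (L : Matrix (Fin 3) (Fin 3) ℝ) + c • (1 : Matrix (Fin 3) (Fin 3) ℝ) = N := by
  refine ⟨N.trace / 3, ⟨N - (N.trace / 3) • (1 : Matrix (Fin 3) (Fin 3) ℝ), ?_⟩, by simp⟩
  simp [Tr0]

/-- For a fixed invertible 3×3 matrix `E` (entries `e^i_a`) and a fixed vector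
`u ∈ ℝ³`, the linear map `(v, v⁰, C, L) ↦ (β, β̃)` with
`β^i_a = Σ ε_{ijk} v^k e^j_a + Σ_j C^{ij} e^j_a` and
`β̃^i_a = Σ_b e^i_b L^b_a + e^i_a v⁰ − u_a v^i`
is a linear isomorphism onto `M₃(ℝ) × M₃(ℝ)`, i.e. any linear map satisfying these formulas is
bijective. -/
theorem beta_coordinate_change_bijective
    (E : Matrix (Fin 3) (Fin 3) ℝ) (hE : IsUnit E.det) (u : Fin 3 → ℝ)
    (F : ((Fin 3 → ℝ) × ℝ × Sym3 × Tr0) →ₗ[ℝ]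
      (Matrix (Fin 3) (Fin 3) ℝ × Matrix (Fin 3) (Fin 3) ℝ))
    (hF : ∀ (v : Fin 3 → ℝ) (v0 : ℝ) (C : Sym3) (L : Tr0),
      (∀ i a : Fin 3, (F (v, v0, C, L)).1 i a =
          (∑ j : Fin 3, ∑ k : Fin 3, eps3 i j k * v k * E j a)
            + ∑ j : Fin 3, (C : Matrix (Fin 3) (Fin 3) ℝ) i j * E j a) ∧
      (∀ i a : Fin 3, (F (v, v0, C, L)).2 i a =
          (∑ b : Fin 3, E i b * (L : Matrix (Fin 3) (Fin 3) ℝ) b a)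
            + E i a * v0 - u a * v i)) :
    Function.Bijective F := by
  have hF' (v : Fin 3 → ℝ) (c : ℝ) (C : Sym3) (L : Tr0) : F (v, c, C, L) =
      ((skewOfVec v + C.1) * E,
        E * (L.1 + c • (1 : Matrix (Fin 3) (Fin 3) ℝ)) - vecMulVec v u) := by
    refine Prod.ext ?_ ?_
    · ext i a
      rw [(hF v c C L).1]
      simp only [← Finset.sum_mul, sum_eps3_mul]
      simp [Matrix.mul_apply, add_mul, Finset.sum_add_distrib]
    · ext i a
      rw [(hF v c C L).2]
      simp [Matrix.mul_add, ← Matrix.mul_apply, vecMulVec_apply, mul_comm]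
  constructor
  · rw [injective_iff_map_eq_zero]
    rintro ⟨v, c, C, L⟩ h
    rw [hF', Prod.mk_eq_zero] at h
    obtain ⟨h₁, h₂⟩ := h
    have h₃ : skewOfVec v + C.1 = 0 := by
      rw [← mul_nonsing_inv_cancel_right E (skewOfVec v + C.1) hE, h₁, Matrix.zero_mul]
    obtain ⟨rfl, hC⟩ := eq_zero_of_skewOfVec_add_eq_zero C.2 h₃
    rw [zero_vecMulVec, sub_zero] at h₂
    have h₄ : L.1 + c • (1 : Matrix (Fin 3) (Fin 3) ℝ) = 0 := by
      rw [← nonsing_inv_mul_cancel_left E (L.1 + c • 1) hE, h₂, Matrix.mul_zero]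
    obtain ⟨rfl, hL⟩ := eq_zero_of_add_smul_one_eq_zero L.2 h₄
    obtain rfl : C = 0 := Subtype.ext hC
    obtain rfl : L = 0 := Subtype.ext hL
    rfl
  · rintro ⟨B, B'⟩
    obtain ⟨v, C, hvC⟩ := exists_skewOfVec_add_eq (B * E⁻¹)
    obtain ⟨c, L, hcL⟩ := exists_add_smul_one_eq (E⁻¹ * (B' + vecMulVec v u))
    refine ⟨(v, c, C, L), ?_⟩
    rw [hF', hvC, hcL, nonsing_inv_mul_cancel_right _ _ hE, mul_nonsing_inv_cancel_left _ _ hE,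
      add_sub_cancel_right]
end

section
/- Let n, e₁, e₂, e₃ ∈ ℝ⁴ satisfy η(n,n) = −1 and η(n,e_a) = 0 for a = 1,2,3, where η is the Minkowski bilinear form. Let q be the 3×3 Gram matrix q_{ab} = η(e_a,e_b); assume det q > 0 and that the 4×4 matrix with columns n, e₁, e₂, e₃ has determinant √(det q). Then for all Q, M, N ∈ {0,1,2,3}: Σ_{b,d,f∈{1,2,3}} ε_{bdf} e_b^Q e_d^M e_f^N = −√(det q) · Σ_{R,S∈{0,1,2,3}} η_{RS} n^S ε_{RQMN}. -/
open scoped BigOperators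

/-- The contraction of three vectors with `eps3` is a `3 × 3` determinant. -/
lemma sum_eps3_mul_s12 (x y z : Fin 3 → ℝ) :
    ∑ b, ∑ d, ∑ f, eps3 b d f * x b * y d * z f = (Matrix.of ![x, y, z]).det := by
  simp [eps3, Fin.sum_univ_three, Matrix.det_fin_three]
  ring

/-- Contracting the first index of `eps4` with a vector gives a `4 × 4` determinant. -/
lemma sum_mul_eps4 (w : Fin 4 → ℝ) (Q M N : Fin 4) :
    ∑ R, w R * eps4 R Q M N
      = (Matrix.of ![w, Pi.single Q 1, Pi.single M 1, Pi.single N 1]).det := by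
  have hrow (R : Fin 4) : eps4 R Q M N
      = (Matrix.of ![Pi.single R 1, Pi.single Q 1, Pi.single M 1, Pi.single N 1]).det := by
    unfold eps4
    congr 1
    ext i j
    fin_cases i <;> simp [Pi.single_apply, eq_comm]
  have hsub (R : Fin 4) (v : Fin 4 → ℝ) (u : Fin 3 → Fin 4 → ℝ) :
      (Matrix.of (Matrix.vecCons v u)).submatrix Fin.succ R.succAbove
        = (Matrix.of u).submatrix id R.succAbove := rfl
  simp only [hrow, Matrix.det_succ_row_zero (n := 3), hsub]
  simp [Pi.single_apply, mul_left_comm, mul_assoc]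

/-- If the first row of a `4 × 4` matrix is supported on the first column, its determinant is the
corresponding entry times the complementary minor. -/
lemma det_cons_single (c : ℝ) (x y z : Fin 4 → ℝ) :
    (Matrix.of ![Pi.single 0 c, x, y, z]).det
      = c * (Matrix.of ![Fin.tail x, Fin.tail y, Fin.tail z]).det := by
  rw [Matrix.det_succ_row_zero, Fin.sum_univ_succ]
  simp [Matrix.det_fin_three, Fin.tail]

/-- If `w ᵥ* A` is `det A` times the first coordinate vector and `A` is nonsingular, then the
minors of `A` omitting the first column are the contractions of `w` with `eps4`. -/
lemma det_tail_rows_eq_sum_mul_eps4 {A : Matrix (Fin 4) (Fin 4) ℝ} (hA : A.det ≠ 0)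
    {w : Fin 4 → ℝ} (hw : Matrix.vecMul w A = Pi.single 0 A.det) (Q M N : Fin 4) :
    (Matrix.of ![Fin.tail (A Q), Fin.tail (A M), Fin.tail (A N)]).det
      = ∑ R, w R * eps4 R Q M N := by
  apply mul_left_cancel₀ hA
  have hmul : Matrix.of ![w, Pi.single Q 1, Pi.single M 1, Pi.single N 1] * A
      = Matrix.of ![Pi.single 0 A.det, A Q, A M, A N] := by
    rw [← hw]
    ext i j
    rw [Matrix.mul_apply_eq_vecMul]
    fin_cases i
    · rfl
    · exact congrFun (Matrix.single_one_vecMul Q A) j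
    · exact congrFun (Matrix.single_one_vecMul M A) j
    · exact congrFun (Matrix.single_one_vecMul N A) j
  rw [sum_mul_eps4, ← det_cons_single, ← hmul, Matrix.det_mul, mul_comm]

/-- For a unit timelike normal `n` and a spatial co-triad `e₁,e₂,e₃`
orthogonal to `n`, with positive Gram determinant and positive orientation, the Levi-Civita
contraction of the triad satisfies
`Σ_{bdf} ε_{bdf} e_b^Q e_d^M e_f^N = −√(det q) Σ_{R,S} η_{RS} n^S ε_{RQMN}`. -/
theorem triad_levi_civita_normal_identity
    (n : Fin 4 → ℝ) (e : Fin 3 → Fin 4 → ℝ)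
    (hn : mink n n = -1) (hne : ∀ a : Fin 3, mink n (e a) = 0)
    (q : Matrix (Fin 3) (Fin 3) ℝ)
    (hq : ∀ a b : Fin 3, q a b = mink (e a) (e b))
    (hdetq : 0 < q.det)
    (hdet : (Matrix.of fun (I α : Fin 4) =>
        (Fin.cons n e : Fin 4 → Fin 4 → ℝ) α I).det = Real.sqrt q.det) :
    ∀ Q M N : Fin 4,
      ∑ b : Fin 3, ∑ d : Fin 3, ∑ f : Fin 3,
          eps3 b d f * e b Q * e d M * e f N
        = -Real.sqrt q.det * ∑ R : Fin 4, ∑ S : Fin 4, eta R S * n S * eps4 R Q M N := by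
  intro Q M N
  set A : Matrix (Fin 4) (Fin 4) ℝ :=
    Matrix.of fun I α => (Fin.cons n e : Fin 4 → Fin 4 → ℝ) α I with hA
  have hA0 : A.det ≠ 0 := by
    rw [hdet]
    exact (Real.sqrt_pos.mpr hdetq).ne'
  have hw : Matrix.vecMul (fun R => -A.det * ∑ S, eta R S * n S) A = Pi.single 0 A.det := by
    have hcontract (v : Fin 4 → ℝ) :
        ∑ R, (-A.det * ∑ S, eta R S * n S) * v R = -A.det * mink n v := by
      simp [mink, eta, Fin.sum_univ_four]
      ring
    ext α
    refine (hcontract _).trans ?_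
    refine Fin.cases ?_ (fun a => ?_) α
    · change -A.det * mink n n = _
      simp [hn]
    · change -A.det * mink n (e a) = _
      simp [hne]
  rw [sum_eps3_mul_s12 (fun b => e b Q) (fun d => e d M) (fun f => e f N)]
  refine (det_tail_rows_eq_sum_mul_eps4 hA0 hw Q M N).trans ?_
  simp only [hdet, Finset.mul_sum, Finset.sum_mul, mul_assoc]
end

section
/- Let e₁, e₂, e₃ ∈ ℝ⁴ with components e_b^I (I ∈ {0,1,2,3}, b ∈ {1,2,3}), and let E be the 3×3 matrix with entries E_{i,b} = e_b^i (i,b ∈ {1,2,3}). Define π^a_{IJ} := Σ_{b,c∈{1,2,3}} Σ_{K,L∈{0,1,2,3}} ε_{abc} ε_{IJKL} e_b^K e_c^L. Then for every c ∈ {1,2,3}: Σ_{a,b∈{1,2,3}} Σ_{i,j,k∈{1,2,3}} ε_{ijk} ε_{abc} π^a_{0i} π^b_{jk} = 16 (det E) e_c^0. -/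
open scoped BigOperators

theorem det_fin_four_eq {R : Type*} [CommRing R] (A : Matrix (Fin 4) (Fin 4) R) :
    A.det =
      A 0 0 * (A 1 1 * (A 2 2 * A 3 3 - A 2 3 * A 3 2) -
        A 1 2 * (A 2 1 * A 3 3 - A 2 3 * A 3 1) +
        A 1 3 * (A 2 1 * A 3 2 - A 2 2 * A 3 1)) -
      A 0 1 * (A 1 0 * (A 2 2 * A 3 3 - A 2 3 * A 3 2) -
        A 1 2 * (A 2 0 * A 3 3 - A 2 3 * A 3 0) +
        A 1 3 * (A 2 0 * A 3 2 - A 2 2 * A 3 0)) +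
      A 0 2 * (A 1 0 * (A 2 1 * A 3 3 - A 2 3 * A 3 1) -
        A 1 1 * (A 2 0 * A 3 3 - A 2 3 * A 3 0) +
        A 1 3 * (A 2 0 * A 3 1 - A 2 1 * A 3 0)) -
      A 0 3 * (A 1 0 * (A 2 1 * A 3 2 - A 2 2 * A 3 1) -
        A 1 1 * (A 2 0 * A 3 2 - A 2 2 * A 3 0) +
        A 1 2 * (A 2 0 * A 3 1 - A 2 1 * A 3 0)) := by
  rw [Matrix.det_succ_row_zero]
  simp [Fin.sum_univ_four, Matrix.det_fin_three, Fin.succAbove]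
  ring

theorem sum_eps3_mul_s13 (a : Fin 3) (f : Fin 3 → Fin 3 → ℝ) :
    ∑ b, ∑ c, eps3 a b c * f b c = f (a + 1) (a + 2) - f (a + 2) (a + 1) := by
  fin_cases a <;> simp [eps3, Matrix.det_fin_three, Fin.sum_univ_three] <;> ring

theorem sum_eps4_zero_succ_mul (i : Fin 3) (f : Fin 4 → Fin 4 → ℝ) :
    ∑ K, ∑ L, eps4 0 i.succ K L * f K L =
      f (i + 1).succ (i + 2).succ - f (i + 2).succ (i + 1).succ := by
  fin_cases i <;>
    simp [eps4, det_fin_four_eq, Fin.sum_univ_four] <;> ring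

theorem sum_eps4_succ_succ_mul (i : Fin 3) (f : Fin 4 → Fin 4 → ℝ) :
    ∑ K, ∑ L, eps4 (i + 1).succ (i + 2).succ K L * f K L = f 0 i.succ - f i.succ 0 := by
  fin_cases i <;>
    simp [eps4, det_fin_four_eq, Fin.sum_univ_four] <;> ring

theorem eps4_swap (I J K L : Fin 4) : eps4 J I K L = -eps4 I J K L := by
  unfold eps4
  have h := Matrix.det_permute (Equiv.swap (0 : Fin 4) 1)
    (Matrix.of fun i j => if (![I, J, K, L]) i = j then (1 : ℝ) else 0)
  rw [Equiv.Perm.sign_swap (by decide)] at h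
  simp only [Units.val_neg, Units.val_one, Int.cast_neg, Int.cast_one, neg_one_mul] at h
  rw [← h]
  congr 1
  ext i j
  fin_cases i <;> rfl

theorem eps3_rotate (a b c : Fin 3) : eps3 a b c = eps3 c a b := by
  fin_cases a <;> fin_cases b <;> fin_cases c <;> simp [eps3, Matrix.det_fin_three]

/-- In the sector `π^a_{IJ} = Σ ε_{abc} ε_{IJKL} e_b^K e_c^L`, the time-gauge
combination of momenta reproduces `e_c^0`:
`Σ ε_{ijk} ε_{abc} π^a_{0i} π^b_{jk} = 16 (det E) e_c^0`, where `E_{i,b} = e_b^i`. -/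
theorem time_gauge_condition_from_momenta
    (e : Fin 3 → Fin 4 → ℝ)
    (E : Matrix (Fin 3) (Fin 3) ℝ)
    (hE : ∀ i b : Fin 3, E i b = e b i.succ)
    (pi : Fin 3 → Fin 4 → Fin 4 → ℝ)
    (hpi : ∀ (a : Fin 3) (I J : Fin 4), pi a I J =
      ∑ b : Fin 3, ∑ c : Fin 3, ∑ K : Fin 4, ∑ L : Fin 4,
        eps3 a b c * eps4 I J K L * e b K * e c L) :
    ∀ c : Fin 3,
      ∑ a : Fin 3, ∑ b : Fin 3, ∑ i : Fin 3, ∑ j : Fin 3, ∑ k : Fin 3,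
          eps3 i j k * eps3 a b c * pi a 0 i.succ * pi b j.succ k.succ
        = 16 * E.det * e c 0 := by
  have hsplit : ∀ a I J, pi a I J =
      ∑ b, ∑ c, eps3 a b c * ∑ K, ∑ L, eps4 I J K L * (e b K * e c L) := by
    intro a I J
    simp only [hpi, Finset.mul_sum, mul_assoc]
  have hspace : ∀ a (i : Fin 3), pi a 0 i.succ =
      2 * (e (a + 1) (i + 1).succ * e (a + 2) (i + 2).succ -
        e (a + 1) (i + 2).succ * e (a + 2) (i + 1).succ) := by
    intro a i
    simp only [hsplit, sum_eps4_zero_succ_mul, sum_eps3_mul_s13]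
    ring
  have htime : ∀ b (i : Fin 3), pi b (i + 1).succ (i + 2).succ =
      2 * (e (b + 1) 0 * e (b + 2) i.succ - e (b + 1) i.succ * e (b + 2) 0) := by
    intro b i
    simp only [hsplit, sum_eps4_succ_succ_mul, sum_eps3_mul_s13]
    ring
  have hanti : ∀ b I J, pi b J I = -pi b I J := by
    intro b I J
    simp only [hpi, eps4_swap I J, mul_neg, neg_mul, Finset.sum_neg_distrib]
  have hcontract : ∀ a b (i : Fin 3),
      ∑ j, ∑ k, eps3 i j k * pi b j.succ k.succ * pi a 0 i.succ =
        2 * pi b (i + 1).succ (i + 2).succ * pi a 0 i.succ := by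
    intro a b i
    simp only [← Finset.sum_mul]
    rw [sum_eps3_mul_s13 i fun j k => pi b j.succ k.succ, hanti b (i + 1).succ (i + 2).succ]
    ring
  intro c
  calc
    _ = ∑ a, ∑ b, eps3 a b c * ∑ i : Fin 3, ∑ j : Fin 3, ∑ k : Fin 3,
        eps3 i j k * pi b j.succ k.succ * pi a 0 i.succ := by
      simp only [Finset.mul_sum]
      congr! 5
      ring
    _ = ∑ a, ∑ b, eps3 c a b * ∑ i : Fin 3,
        2 * pi b (i + 1).succ (i + 2).succ * pi a 0 i.succ := by
      simp only [hcontract, eps3_rotate]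
    _ = 16 * E.det * e c 0 := by
      rw [sum_eps3_mul_s13 c fun a b => ∑ i : Fin 3,
        2 * pi b (i + 1).succ (i + 2).succ * pi a 0 i.succ]
      simp only [hspace, htime, Matrix.det_fin_three, hE, Fin.sum_univ_three]
      fin_cases c <;> simp <;> ring
end
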